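/- Let X be a compact metric space, let P be a compact (in the weak-* topology) set of Borel probability measures on X, let F be a set of continuous functions dense in C(X, ℝ), and let σ: ℝ → ℝ be continuous and not an algebraic polynomial. Then Σ(σ, A^F) is ρ_μ-dense in the space of Borel measurable real-valued functions on P for any finite Borel measure μ on P: for every Borel measurable f: P → ℝ and every ε > 0 there exists g ∈ Σ(σ, A^F) such that μ({p ∈ P : |f(p) − g(p)| ≥ ε}) < ε. -/

import Mathlib

open MeasureTheory
open Filter Topology Polynomial
open scoped ContDiff Convolution

theorem exists_polynomial_of_iteratedDeriv_eq_zero (n : ℕ) (f : ℝ → ℝ) (hf : ContDiff ℝ ∞ f)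
    (h : ∀ x, iteratedDeriv n f x = 0) : ∃ q : ℝ[X], q.degree < n ∧ ∀ x, f x = q.eval x := by
  suffices H : ∃ c : ℕ → ℝ, ∀ x, f x = ∑ i ∈ Finset.range n, c i * x ^ i by
    obtain ⟨c, hc⟩ := H
    refine ⟨∑ i ∈ Finset.range n, C (c i) * X ^ i, ?_, fun x => ?_⟩
    · refine (degree_sum_le _ _).trans_lt ((Finset.sup_lt_iff (WithBot.bot_lt_coe n)).2 ?_)
      intro i hi
      exact (degree_C_mul_X_pow_le _ _).trans_lt (Nat.cast_lt.2 (Finset.mem_range.1 hi))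
    · simp [eval_finsetSum, hc]
  induction n generalizing f with
  | zero => exact ⟨0, by simpa using h⟩
  | succ n ih =>
    obtain ⟨hd, hf'⟩ := contDiff_infty_iff_deriv.1 hf
    obtain ⟨c, hc⟩ := ih (deriv f) hf' (by simpa only [iteratedDeriv_succ'] using h)
    let G : ℝ → ℝ := fun x => ∑ i ∈ Finset.range n, c i / (i + 1) * x ^ (i + 1)
    have hG (x : ℝ) : HasDerivAt G (deriv f x) x := by
      rw [hc]
      refine HasDerivAt.fun_sum fun i _ => ?_
      refine ((hasDerivAt_pow (i + 1) x).const_mul (c i / (i + 1))).congr_deriv ?_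
      rw [Nat.add_sub_cancel]
      push_cast
      field_simp
    have hconst (x : ℝ) : f x - G x = f 0 - G 0 :=
      is_const_of_deriv_eq_zero (f := fun x => f x - G x)
        (fun x => ((hd x).hasDerivAt.sub (hG x)).differentiableAt)
        (fun x => (((hd x).hasDerivAt.sub (hG x)).deriv).trans (sub_self _)) x 0
    refine ⟨fun i => if i = 0 then f 0 else c (i - 1) / ((i - 1 : ℕ) + 1), fun x => ?_⟩
    have h0 : G 0 = 0 := by simp [G]
    have hx := hconst x
    rw [h0] at hx
    rw [Finset.sum_range_succ']
    simp only [Nat.add_sub_cancel, Nat.add_eq_zero_iff, one_ne_zero, and_false, if_false, if_true,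
      pow_zero, mul_one]
    change f x = G x + f 0
    linarith

theorem exists_polynomial_of_tendsto {ι : Type*} {l : Filter ι} [l.NeBot] (n : ℕ)
    (q : ι → ℝ[X]) (hq : ∀ i, (q i).degree < n) (f : ℝ → ℝ)
    (h : ∀ x, Tendsto (fun i => (q i).eval x) l (𝓝 (f x))) :
    ∃ p : ℝ[X], ∀ x, f x = p.eval x := by
  have hinj : Set.InjOn (fun k : ℕ => (k : ℝ)) (Finset.range n) := Nat.cast_injective.injOn
  refine ⟨Lagrange.interpolate (Finset.range n) (fun k : ℕ => (k : ℝ)) fun k => f k, fun x => ?_⟩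
  refine tendsto_nhds_unique (h x) ?_
  have hi (i : ι) := Lagrange.eq_interpolate (f := q i) hinj (by simpa using hq i)
  have : (fun i => (q i).eval x) = fun i => ∑ k ∈ Finset.range n,
      (q i).eval (k : ℝ) *
        (Lagrange.basis (Finset.range n) (fun k : ℕ => (k : ℝ)) k).eval x := by
    ext i
    conv_lhs => rw [hi i]
    simp [Lagrange.interpolate_apply, eval_finsetSum]
  rw [this]
  simp only [Lagrange.interpolate_apply, eval_finsetSum, eval_mul, eval_C]
  exact tendsto_finsetSum _ fun k _ => (h k).mul_const _

theorem Submodule.integral_mem_of_isClosed {E : Type*} [NormedAddCommGroup E] [NormedSpace ℝ E]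
    [CompleteSpace E] (V : Submodule ℝ E) (hV : IsClosed (V : Set E)) {φ : ℝ → E}
    (hφ : Continuous φ) (hc : HasCompactSupport φ) (h : ∀ s, φ s ∈ V) :
    ∫ s, φ s ∈ V := by
  have : CompleteSpace V := hV.completeSpace_coe
  let ψ : ℝ → V := fun s => ⟨φ s, h s⟩
  have hψ : Continuous ψ := hφ.subtype_mk _
  have hcψ : HasCompactSupport ψ := by
    refine hc.mono fun s hs => ?_
    contrapose! hs
    simpa [ψ, Subtype.ext_iff] using hs
  have := V.subtypeL.integral_comp_comm (hψ.integrable_of_hasCompactSupport (μ := volume) hcψ)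
  change ∫ s, φ s = _ at this
  rw [this]
  exact Subtype.property _

section

variable {K : Type*} [TopologicalSpace K] [CompactSpace K] (V : Submodule ℝ C(K, ℝ))

theorem pow_succ_mul_deriv_comp_mem (hV : IsClosed (V : Set C(K, ℝ))) (a : C(K, ℝ)) (j : ℕ)
    (f f' : C(ℝ, ℝ)) (hd : ∀ x, HasDerivAt f (f' x) x)
    (h : ∀ l b : ℝ, a ^ j * f.comp (l • a + .const K b) ∈ V) (l b : ℝ) :
    a ^ (j + 1) * f'.comp (l • a + .const K b) ∈ V := by
  let G : ℝ → C(K, ℝ) := fun s => a ^ (j + 1) * f'.comp (s • a + .const K b)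
  let u : ℝ → C(K, ℝ) := fun s => a ^ j * f.comp (s • a + .const K b)
  have hG : Continuous G := by
    refine ContinuousMap.continuous_of_continuous_uncurry _ ?_
    simp only [G, Function.uncurry_def, ContinuousMap.mul_apply, ContinuousMap.pow_apply,
      ContinuousMap.comp_apply, ContinuousMap.add_apply, ContinuousMap.smul_apply,
      ContinuousMap.const_apply]
    fun_prop
  have hu (s : ℝ) : u s = u l + ∫ r in l..s, G r := by
    ext t
    have h1 := (ContinuousMap.evalCLM ℝ t : C(K, ℝ) →L[ℝ] ℝ).intervalIntegral_comp_comm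
      (hG.intervalIntegrable (μ := volume) l s)
    have h2 : ∫ r in l..s, G r t = u s t - u l t := by
      refine intervalIntegral.integral_eq_sub_of_hasDerivAt (f := fun r => u r t) (fun r _ => ?_)
        (Continuous.intervalIntegrable
          ((ContinuousMap.evalCLM ℝ t : C(K, ℝ) →L[ℝ] ℝ).continuous.comp hG) _ _)
      have h3 : HasDerivAt (fun r : ℝ => r * a t + b) (a t) r := by
        simpa using ((hasDerivAt_id r).mul_const (a t)).add_const b
      refine (((hd (r * a t + b)).comp r h3).const_mul (a t ^ j)).congr_deriv ?_
      simp only [G, ContinuousMap.mul_apply, ContinuousMap.pow_apply, ContinuousMap.comp_apply,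
        ContinuousMap.add_apply, ContinuousMap.smul_apply, ContinuousMap.const_apply, smul_eq_mul]
      ring
    change ∫ r in l..s, G r t = (∫ r in l..s, G r) t at h1
    rw [ContinuousMap.add_apply, ← h1, h2]
    ring
  have hder : HasDerivAt u (G l) l := by
    rw [funext hu]
    exact (intervalIntegral.integral_hasDerivAt_right (hG.intervalIntegrable _ _)
      hG.aestronglyMeasurable.stronglyMeasurableAtFilter hG.continuousAt).const_add _
  exact hV.mem_of_tendsto hder.tendsto_slope <| Eventually.of_forall fun s =>
    V.smul_mem _ (V.sub_mem (h s b) (h l b))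

theorem pow_mul_iteratedDeriv_mem (hV : IsClosed (V : Set C(K, ℝ))) (a : C(K, ℝ))
    (f : ℝ → ℝ) (hf : ContDiff ℝ ∞ f)
    (h : ∀ l b : ℝ, (⟨f, hf.continuous⟩ : C(ℝ, ℝ)).comp (l • a + .const K b) ∈ V)
    (k : ℕ) (b : ℝ) : iteratedDeriv k f b • a ^ k ∈ V := by
  have hc (k : ℕ) : Continuous (iteratedDeriv k f) :=
    hf.continuous_iteratedDeriv k (by exact_mod_cast le_top)
  suffices H : ∀ l b : ℝ,
      a ^ k * (⟨iteratedDeriv k f, hc k⟩ : C(ℝ, ℝ)).comp (l • a + .const K b) ∈ V by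
    convert H 0 b using 1
    ext t
    simp [mul_comm]
  induction k with
  | zero => simpa using h
  | succ k ih =>
    refine pow_succ_mul_deriv_comp_mem V hV a k ⟨_, hc k⟩ ⟨_, hc (k + 1)⟩ (fun x => ?_) ih
    have : DifferentiableAt ℝ (iteratedDeriv k f) x :=
      hf.differentiable_iteratedDeriv k (by exact_mod_cast WithTop.coe_lt_top _) x
    simpa [iteratedDeriv_succ] using this.hasDerivAt

theorem convolution_comp_mem (hV : IsClosed (V : Set C(K, ℝ))) (a : C(K, ℝ))
    (σ g φ : C(ℝ, ℝ)) (hφc : HasCompactSupport φ)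
    (hg : ∀ x, g x = ∫ s, φ s * σ (x - s))
    (h : ∀ b : ℝ, σ.comp (a + .const K b) ∈ V) : g.comp a ∈ V := by
  let G : ℝ → C(K, ℝ) := fun s => φ s • σ.comp (a + .const K (-s))
  have hG : Continuous G := by
    refine ContinuousMap.continuous_of_continuous_uncurry _ ?_
    simp only [G, Function.uncurry_def, ContinuousMap.smul_apply,
      ContinuousMap.comp_apply, ContinuousMap.add_apply, ContinuousMap.const_apply]
    fun_prop
  have hGc : HasCompactSupport G := hφc.smul_right
  have key : g.comp a = ∫ s, G s := by
    ext t
    have h1 := (ContinuousMap.evalCLM ℝ t : C(K, ℝ) →L[ℝ] ℝ).integral_comp_comm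
      (hG.integrable_of_hasCompactSupport (μ := volume) hGc)
    change ∫ s, G s t = (∫ s, G s) t at h1
    rw [← h1, ContinuousMap.comp_apply, hg]
    simp [G, sub_eq_add_neg]
  rw [key]
  exact V.integral_mem_of_isClosed hV hG hGc fun s => V.smul_mem _ (h _)

theorem pow_mem_of_comp_mem (hV : IsClosed (V : Set C(K, ℝ))) (a : C(K, ℝ)) (σ : C(ℝ, ℝ))
    (hσ : ¬ ∃ q : ℝ[X], ∀ t : ℝ, σ t = q.eval t)
    (h : ∀ l b : ℝ, σ.comp (l • a + .const K b) ∈ V) (k : ℕ) : a ^ k ∈ V := by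
  by_contra hk
  apply hσ
  let φ : ℕ → ContDiffBump (0 : ℝ) := fun n =>
    ⟨1 / (n + 1) / 2, 1 / (n + 1), by positivity, half_lt_self (by positivity)⟩
  let g : ℕ → ℝ → ℝ := fun n => (φ n).normed volume ⋆[ContinuousLinearMap.lsmul ℝ ℝ, volume] σ
  have hgs (n : ℕ) : ContDiff ℝ ∞ (g n) :=
    (φ n).hasCompactSupport_normed.contDiff_convolution_left _ (φ n).contDiff_normed
      σ.continuous.locallyIntegrable
  have hgV (n : ℕ) (l b : ℝ) :
      (⟨g n, (hgs n).continuous⟩ : C(ℝ, ℝ)).comp (l • a + .const K b) ∈ V := by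
    refine convolution_comp_mem V hV _ σ _ ⟨(φ n).normed volume, (φ n).continuous_normed⟩
      (φ n).hasCompactSupport_normed (fun x => ?_) fun b' => ?_
    · simp [g, convolution_def]
    · convert h l (b + b') using 2
      ext t
      simp [add_assoc]
  have hpoly (n : ℕ) : ∃ q : ℝ[X], q.degree < k ∧ ∀ x, g n x = q.eval x := by
    refine exists_polynomial_of_iteratedDeriv_eq_zero k (g n) (hgs n) fun b => ?_
    by_contra hb
    exact hk ((V.smul_mem_iff hb).1 (pow_mul_iteratedDeriv_mem V hV a (g n) (hgs n) (hgV n) k b))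
  choose q hqd hq using hpoly
  refine exists_polynomial_of_tendsto (l := atTop) k q hqd σ fun x => ?_
  simp only [← hq]
  exact ContDiffBump.convolution_tendsto_right_of_continuous
    tendsto_one_div_add_atTop_nhds_zero_nat σ.continuous x

theorem exp_mem_of_comp_mem (hV : IsClosed (V : Set C(K, ℝ))) (a : C(K, ℝ)) (σ : C(ℝ, ℝ))
    (hσ : ¬ ∃ q : ℝ[X], ∀ t : ℝ, σ t = q.eval t)
    (h : ∀ l b : ℝ, σ.comp (l • a + .const K b) ∈ V) : NormedSpace.exp a ∈ V :=
  hV.mem_of_tendsto (NormedSpace.exp_series_hasSum_exp' (𝕂 := ℝ) a) <|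
    Eventually.of_forall fun _ => V.sum_mem fun k _ =>
      V.smul_mem _ (pow_mem_of_comp_mem V hV a σ hσ h k)

/-- If a closed subspace `V` of `C(K, ℝ)` contains all `σ ∘ (a + b)` for `a` in a point-separating
subspace and `b` constant, with `σ` not a polynomial, then `V` is everything. -/
theorem eq_top_of_comp_mem (hV : IsClosed (V : Set C(K, ℝ))) (A : Submodule ℝ C(K, ℝ))
    (hA : ∀ x y, x ≠ y → ∃ a ∈ A, a x ≠ a y) (σ : C(ℝ, ℝ))
    (hσ : ¬ ∃ q : ℝ[X], ∀ t : ℝ, σ t = q.eval t)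
    (h : ∀ a ∈ A, ∀ b : ℝ, σ.comp (a + .const K b) ∈ V) : V = ⊤ := by
  let M : Submonoid C(K, ℝ) :=
    { carrier := NormedSpace.exp '' (A : Set C(K, ℝ))
      one_mem' := ⟨0, A.zero_mem, NormedSpace.exp_zero⟩
      mul_mem' := by
        rintro _ _ ⟨a, ha, rfl⟩ ⟨b, hb, rfl⟩
        exact ⟨a + b, A.add_mem ha hb, NormedSpace.exp_add⟩ }
  let B := Algebra.adjoin ℝ (M : Set C(K, ℝ))
  have hBV : (B : Set C(K, ℝ)) ⊆ V := by
    have : Subalgebra.toSubmodule B ≤ V := by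
      rw [Algebra.adjoin_eq_span_of_subset _ (by simp), Submodule.span_le]
      rintro _ ⟨a, ha, rfl⟩
      exact exp_mem_of_comp_mem V hV a σ hσ fun l b => h _ (A.smul_mem l ha) b
    exact this
  have hB : B.topologicalClosure = ⊤ := by
    refine ContinuousMap.subalgebra_topologicalClosure_eq_top_of_separatesPoints _ fun x y hxy => ?_
    obtain ⟨a, ha, hne⟩ := hA x y hxy
    refine ⟨_, ⟨NormedSpace.exp a, Algebra.subset_adjoin ⟨a, ha, rfl⟩, rfl⟩, ?_⟩
    have hexp (z : K) : NormedSpace.exp a z = Real.exp (a z) := by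
      rw [Real.exp_eq_exp_ℝ]
      exact NormedSpace.map_exp (ContinuousMap.evalAlgHom ℝ ℝ z)
        (ContinuousMap.evalCLM ℝ z : C(K, ℝ) →L[ℝ] ℝ).continuous a
    simpa [hexp] using hne
  rw [eq_top_iff]
  intro f _
  have hf : f ∈ B.topologicalClosure := hB ▸ trivial
  exact closure_minimal hBV hV hf

end

/-- Measurable functions are approximable in measure by continuous functions. -/
theorem exists_continuous_measure_le_abs_sub_lt {Y : Type*} [TopologicalSpace Y] [NormalSpace Y]
    [MeasurableSpace Y] [BorelSpace Y] (μ : Measure Y) [IsFiniteMeasure μ] [μ.WeaklyRegular]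
    {f : Y → ℝ} (hf : Measurable f) {ε : ℝ} (hε : 0 < ε) :
    ∃ g : C(Y, ℝ), μ {y | ε ≤ |f y - g y|} < ENNReal.ofReal ε := by
  have hlim : Tendsto (fun n : ℕ => μ {y | (n : ℝ) < |f y|}) atTop (𝓝 0) := by
    have h0 : (⋂ n : ℕ, {y | (n : ℝ) < |f y|}) = ∅ := by
      ext y
      obtain ⟨n, hn⟩ := exists_nat_ge |f y|
      simpa using ⟨n, hn⟩
    rw [← measure_empty (μ := μ), ← h0]
    refine tendsto_measure_iInter_atTop
      (fun n => (measurableSet_lt measurable_const hf.abs).nullMeasurableSet)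
      (fun m n hmn y hy => ?_) ⟨0, measure_ne_top _ _⟩
    exact (Nat.cast_le.2 hmn).trans_lt (Set.mem_ofPred_eq ▸ hy)
  have hε2 : 0 < ENNReal.ofReal (ε / 2) := ENNReal.ofReal_pos.2 (by positivity)
  obtain ⟨n, hn⟩ := (hlim.eventually (gt_mem_nhds hε2)).exists
  let f' : Y → ℝ := fun y => max (-n) (min (f y) n)
  have hf'm : Measurable f' := measurable_const.max (hf.min measurable_const)
  have hf' : MemLp f' 1 μ := by
    refine MemLp.of_bound hf'm.aestronglyMeasurable n (Eventually.of_forall fun y => ?_)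
    rw [Real.norm_eq_abs, abs_le]
    exact ⟨le_max_left _ _, max_le (by linarith [Nat.cast_nonneg (α := ℝ) n]) (min_le_right _ _)⟩
  have hδ : ENNReal.ofReal ε * ENNReal.ofReal (ε / 2) ≠ 0 :=
    mul_ne_zero (ENNReal.ofReal_pos.2 hε).ne' hε2.ne'
  obtain ⟨g, hg, hgm⟩ := hf'.exists_boundedContinuous_eLpNorm_sub_le ENNReal.one_ne_top hδ
  refine ⟨g.toContinuousMap, ?_⟩
  have hmarkov : μ {y | ε ≤ |f' y - g y|} ≤ ENNReal.ofReal (ε / 2) := by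
    have := mul_meas_ge_le_lintegral₀ (μ := μ) (f := fun y => ‖(f' - g) y‖ₑ)
      (hf'.sub hgm).aestronglyMeasurable.enorm (ENNReal.ofReal ε)
    rw [← eLpNorm_one_eq_lintegral_enorm] at this
    have h2 := (ENNReal.mul_le_mul_iff_right (ENNReal.ofReal_pos.2 hε).ne'
      ENNReal.ofReal_ne_top).1 (this.trans hg)
    refine (measure_mono fun y hy => ?_).trans h2
    simp only [Set.mem_ofPred_eq, Pi.sub_apply] at hy ⊢
    rw [← ofReal_norm, Real.norm_eq_abs]
    exact ENNReal.ofReal_le_ofReal hy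
  calc μ {y | ε ≤ |f y - g y|}
      ≤ μ ({y | (n : ℝ) < |f y|} ∪ {y | ε ≤ |f' y - g y|}) := by
        refine measure_mono fun y hy => ?_
        by_cases hy' : (n : ℝ) < |f y|
        · exact Or.inl hy'
        · right
          obtain ⟨h1, h2⟩ := abs_le.1 (not_lt.1 hy')
          have : f' y = f y := by simp [f', h1, h2]
          simpa [this] using hy
    _ ≤ _ := measure_union_le _ _
    _ < ENNReal.ofReal (ε / 2) + ENNReal.ofReal (ε / 2) :=
        ENNReal.add_lt_add_of_lt_of_le (measure_ne_top _ _) hn hmarkov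
    _ = ENNReal.ofReal ε := by
        rw [← ENNReal.ofReal_add (by positivity) (by positivity), add_halves]

section

variable {X : Type*} [MetricSpace X] [CompactSpace X] [MeasurableSpace X] [BorelSpace X]
  (P : Set (ProbabilityMeasure X))

theorem integrable_continuousMap (p : ProbabilityMeasure X) (h : C(X, ℝ)) :
    Integrable h (p : Measure X) :=
  h.continuous.integrable_of_hasCompactSupport (HasCompactSupport.of_compactSpace h)

/-- Integration of continuous functions, as a map to continuous functions on a compact set of
probability measures. -/
noncomputable def integralCLM [CompactSpace P] : C(X, ℝ) →L[ℝ] C(P, ℝ) :=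
  LinearMap.mkContinuous
    { toFun := fun h => ⟨fun p => ∫ x, h x ∂((p : ProbabilityMeasure X) : Measure X),
        (ProbabilityMeasure.continuous_integral_boundedContinuousFunction
          (BoundedContinuousFunction.mkOfCompact h)).comp continuous_subtype_val⟩
      map_add' := fun h k => by
        ext p
        exact integral_add (integrable_continuousMap _ h) (integrable_continuousMap _ k)
      map_smul' := fun c h => by
        ext p
        exact integral_const_mul c _ }
    1 fun h => by
      rw [one_mul, ContinuousMap.norm_le _ (norm_nonneg h)]
      intro p
      refine (norm_integral_le_of_norm_le_const
        (μ := ((p : ProbabilityMeasure X) : Measure X))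
        (Eventually.of_forall fun x => h.norm_coe_le_norm x)).trans ?_
      simp

@[simp]
theorem integralCLM_apply [CompactSpace P] (h : C(X, ℝ)) (p : P) :
    integralCLM P h p = ∫ x, h x ∂((p : ProbabilityMeasure X) : Measure X) :=
  rfl

theorem exists_integralCLM_ne [CompactSpace P] (p q : P) (hpq : p ≠ q) :
    ∃ h : C(X, ℝ), integralCLM P h p ≠ integralCLM P h q := by
  by_contra! H
  refine hpq (Subtype.ext (Subtype.ext ?_))
  have (r : ProbabilityMeasure X) : IsProbabilityMeasure r.val := r.2
  exact ext_of_forall_integral_eq_of_IsFiniteMeasure fun f => H f.toContinuousMap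

/-- A closed subspace containing all single neurons with features in a dense set and a
non-polynomial activation is everything. -/
theorem eq_top_of_comp_integralCLM_mem [CompactSpace P] (F : Set C(X, ℝ)) (hF : Dense F)
    (σ : C(ℝ, ℝ)) (hσ : ¬ ∃ q : ℝ[X], ∀ t : ℝ, σ t = q.eval t) (V : Submodule ℝ C(P, ℝ))
    (hV : IsClosed (V : Set C(P, ℝ)))
    (h : ∀ k ∈ F, ∀ b : ℝ, σ.comp (integralCLM P k + .const P b) ∈ V) : V = ⊤ := by
  refine eq_top_of_comp_mem V hV (LinearMap.range (integralCLM P).toLinearMap) ?_ σ hσ ?_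
  · intro p q hpq
    obtain ⟨k, hk⟩ := exists_integralCLM_ne P p q hpq
    exact ⟨_, ⟨k, rfl⟩, hk⟩
  · rintro _ ⟨k, rfl⟩ b
    have hcont : Continuous fun k : C(X, ℝ) => σ.comp (integralCLM P k + .const P b) :=
      (ContinuousMap.continuous_postcomp σ).comp
        ((integralCLM P).continuous.add continuous_const)
    exact (hV.preimage hcont).closure_subset_iff.2 (fun k hk => h k hk b) (hF k)

end

/-- ρ_μ-density of Σ(σ, A^F) in the measurable functions on P: for any finite
Borel measure μ on the compact set P of probability measures, any Borel
measurable f : P → ℝ and ε > 0, some member g of Σ(σ, A^F) satisfies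
μ{p : |f p - g p| ≥ ε} < ε. -/
theorem stmt_8 {X : Type*} [MetricSpace X] [CompactSpace X]
    [MeasurableSpace X] [BorelSpace X]
    (P : Set (ProbabilityMeasure X)) (hP : IsCompact P)
    (F : Set C(X, ℝ)) (hF : Dense F)
    (σ : ℝ → ℝ) (hσ_cont : Continuous σ)
    (hσ_nonpoly : ¬ ∃ q : Polynomial ℝ, ∀ t : ℝ, σ t = q.eval t)
    [MeasurableSpace ↥P] [BorelSpace ↥P]
    (μ : Measure ↥P) [IsFiniteMeasure μ]
    (f : ↥P → ℝ) (hf : Measurable f) :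
    ∀ ε > 0, ∃ (n : ℕ) (m : Fin n → ℕ) (α : Fin n → ℝ) (b : Fin n → ℝ)
      (w : (i : Fin n) → Fin (m i) → ℝ)
      (g : (i : Fin n) → Fin (m i) → C(X, ℝ)),
      (∀ i j, g i j ∈ F) ∧
      μ {p : ↥P | ε ≤ |f p - ∑ i, α i * σ (b i + ∑ j, w i j *
          ∫ x, g i j x ∂((p : ProbabilityMeasure X) : Measure X))|}
        < ENNReal.ofReal ε := by
  intro ε hε
  have : CompactSpace P := isCompact_iff_compactSpace.1 hP
  obtain ⟨G, hG⟩ := exists_continuous_measure_le_abs_sub_lt μ hf (half_pos hε)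
  have hclos : G ∈ (Submodule.span ℝ (Set.range fun i : ℝ × F =>
      (⟨σ, hσ_cont⟩ : C(ℝ, ℝ)).comp (integralCLM P i.2 + .const P i.1))).topologicalClosure := by
    rw [eq_top_of_comp_integralCLM_mem P F hF ⟨σ, hσ_cont⟩ hσ_nonpoly _
      (Submodule.isClosed_topologicalClosure _)]
    · trivial
    · exact fun k hk b =>
        Submodule.le_topologicalClosure _ (Submodule.subset_span ⟨(b, ⟨k, hk⟩), rfl⟩)
  obtain ⟨N, hN, hdist⟩ := Metric.mem_closure_iff.1 hclos (ε / 2) (half_pos hε)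
  obtain ⟨n, α, s, hs⟩ := Submodule.mem_span_set'.1 hN
  choose i hi using fun k => (s k).2
  refine ⟨n, fun _ => 1, α, fun k => (i k).1, fun _ _ => 1, fun k _ => (i k).2,
    fun k _ => (i k).2.2, ?_⟩
  have hNp (p : P) : ∑ k, α k * σ ((i k).1 + ∑ _j : Fin 1, 1 *
      ∫ x, ((i k).2 : C(X, ℝ)) x ∂((p : ProbabilityMeasure X) : Measure X)) = N p := by
    simp [← hs, ← hi, ContinuousMap.sum_apply, add_comm]
  simp only [hNp]
  refine (measure_mono fun p hp => ?_).trans_lt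
    (hG.trans_le (ENNReal.ofReal_le_ofReal (half_le_self hε.le)))
  have h1 : |G p - N p| < ε / 2 := (ContinuousMap.dist_apply_le_dist p).trans_lt hdist
  have h2 : ε ≤ |f p - N p| := hp
  have h3 := abs_sub_le (f p) (G p) (N p)
  change ε / 2 ≤ |f p - G p|
  linarith
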